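/- arXiv:1303.4499 — 2 statements merged into one kernel-verified Lean document; each statement's English description precedes it below -/
import Mathlib

section
/- Let p,n be positive integers, 0 ≤ λ ≤ 1, and let f ∈ A(p,n) with F_λ(z)F_λ'(z) ≠ 0 on U\{0}, where F_λ(z) = (1−λ)f(z) + λzf'(z). Let δ ∈ [0,p) and define ς(δ) = −nδ/(2(p−δ)) if δ ∈ [0,p/2], and ς(δ) = −n(p−δ)/(2δ) if δ ∈ [p/2,p). If Re[ −zF_λ'(z)/F_λ(z) + 1 + zF_λ''(z)/F_λ'(z) ] > ς(δ) for all z ∈ U, then Re[ zF_λ'(z)/F_λ(z) ] > δ for all z ∈ U. -/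
open Metric Complex

theorem norm_sub_one_le_of_re_nonneg {P k : ℂ → ℂ} {n : ℕ} {r : ℝ} (hr : 0 < r)
    (hP : ∀ z ∈ closedBall (0 : ℂ) r, DifferentiableAt ℂ P z)
    (hk : ∀ z ∈ closedBall (0 : ℂ) r, DifferentiableAt ℂ k z)
    (hPk : ∀ z ∈ closedBall (0 : ℂ) r, P z = 1 + z ^ n * k z)
    (hre : ∀ z ∈ closedBall (0 : ℂ) r, 0 ≤ (P z).re) {z : ℂ} (hz : z ∈ closedBall (0 : ℂ) r) :
    ‖P z - 1‖ ≤ (‖z‖ / r) ^ n * ‖P z + 1‖ := by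
  have hne : ∀ z ∈ closedBall (0 : ℂ) r, P z + 1 ≠ 0 := fun z hz h ↦ by
    have := congrArg re h
    have := hre z hz
    simp at *
    linarith
  have hd : DiffContOnCl ℂ (fun z ↦ k z / (P z + 1)) (ball 0 r) := by
    refine DifferentiableOn.diffContOnCl fun z hz ↦ ?_
    rw [closure_ball _ hr.ne'] at hz
    exact ((hk z hz).div ((hP z hz).add_const 1) (hne z hz)).differentiableWithinAt
  have hfr : ∀ z ∈ frontier (ball (0 : ℂ) r), ‖k z / (P z + 1)‖ ≤ 1 / r ^ n := by
    intro z hz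
    rw [frontier_ball _ hr.ne'] at hz
    have hzc := sphere_subset_closedBall hz
    have hzr : ‖z‖ = r := by simpa using hz
    have h1 : ‖P z - 1‖ ≤ ‖P z + 1‖ := by
      rw [← sq_le_sq₀ (norm_nonneg _) (norm_nonneg _), Complex.sq_norm, Complex.sq_norm,
        normSq_apply, normSq_apply]
      have := hre z hzc
      simp
      nlinarith
    have h2 : ‖P z - 1‖ = r ^ n * ‖k z‖ := by
      rw [hPk z hzc, add_sub_cancel_left, norm_mul, norm_pow, hzr]
    rw [norm_div, div_le_div_iff₀ (norm_pos_iff.2 (hne z hzc)) (by positivity)]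
    linarith
  have hb := norm_le_of_forall_mem_frontier_norm_le isBounded_ball hd hfr
    (by rwa [closure_ball _ hr.ne'])
  rw [norm_div, div_le_div_iff₀ (norm_pos_iff.2 (hne z hz)) (by positivity)] at hb
  have h2 : ‖P z - 1‖ = ‖z‖ ^ n * ‖k z‖ := by
    rw [hPk z hz, add_sub_cancel_left, norm_mul, norm_pow]
  rw [h2, div_pow, div_mul_eq_mul_div, le_div_iff₀ (by positivity), mul_assoc]
  gcongr
  linarith

theorem HasDerivAt.nonpos_of_nonneg_left {φ : ℝ → ℝ} {φ' x : ℝ} (h : HasDerivAt φ φ' x)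
    (hx : φ x = 0) (hφ : ∀ᶠ t in nhdsWithin x (Set.Iio x), 0 ≤ φ t) : φ' ≤ 0 := by
  have hs := (hasDerivAt_iff_tendsto_slope.1 h).mono_left
    (nhdsWithin_mono x (s := Set.Iio x) fun t ht ↦ ne_of_lt ht)
  have : (nhdsWithin x (Set.Iio x)).NeBot := inferInstance
  refine le_of_tendsto (hs : Filter.Tendsto _ (nhdsWithin x (Set.Iio x)) _) ?_
  filter_upwards [hφ, self_mem_nhdsWithin] with t ht htx
  rw [slope_def_field, hx, sub_zero]
  exact div_nonpos_of_nonneg_of_nonpos ht (sub_nonpos.2 (le_of_lt htx))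

theorem im_mul_deriv_eq_zero_of_re_nonneg {P : ℂ → ℂ} {z₀ : ℂ}
    (hP : DifferentiableAt ℂ P z₀)
    (hre : ∀ z ∈ closedBall (0 : ℂ) ‖z₀‖, 0 ≤ (P z).re) (h₀ : (P z₀).re = 0) :
    (z₀ * deriv P z₀).im = 0 := by
  have hc : HasDerivAt (fun θ : ℂ ↦ z₀ * exp (θ * I)) (z₀ * I) ((0 : ℝ) : ℂ) := by
    simpa using (((hasDerivAt_id (0 : ℂ)).mul_const I).cexp).const_mul z₀
  have hP' : HasDerivAt P (deriv P z₀) (z₀ * exp (((0 : ℝ) : ℂ) * I)) := by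
    simpa using hP.hasDerivAt
  have hd := (HasDerivAt.comp ((0 : ℝ) : ℂ) hP' hc).real_of_complex
  have hmin : IsLocalMin (fun θ : ℝ ↦ (P (z₀ * exp (θ * I))).re) 0 := by
    refine Filter.Eventually.of_forall fun θ ↦ ?_
    have := hre (z₀ * exp (θ * I)) (by simp [norm_exp_ofReal_mul_I])
    simpa [h₀] using this
  have := hmin.hasDerivAt_eq_zero hd
  simp at this ⊢
  linarith

theorem re_mul_deriv_le_of_re_nonneg {P k : ℂ → ℂ} {n : ℕ} {z₀ : ℂ} (hz₀ : z₀ ≠ 0)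
    (hP : ∀ z ∈ closedBall (0 : ℂ) ‖z₀‖, DifferentiableAt ℂ P z)
    (hk : ∀ z ∈ closedBall (0 : ℂ) ‖z₀‖, DifferentiableAt ℂ k z)
    (hPk : ∀ z ∈ closedBall (0 : ℂ) ‖z₀‖, P z = 1 + z ^ n * k z)
    (hre : ∀ z ∈ closedBall (0 : ℂ) ‖z₀‖, 0 ≤ (P z).re) (h₀ : (P z₀).re = 0) :
    (z₀ * deriv P z₀).re ≤ -(n * (1 + (P z₀).im ^ 2)) / 2 := by
  have hr : 0 < ‖z₀‖ := norm_pos_iff.2 hz₀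
  have hc : HasDerivAt (fun t : ℂ ↦ t * z₀) z₀ ((1 : ℝ) : ℂ) := by
    simpa using (hasDerivAt_id (1 : ℂ)).mul_const z₀
  have hP' : HasDerivAt P (deriv P z₀) (((1 : ℝ) : ℂ) * z₀) := by
    simpa using (hP z₀ (by simp)).hasDerivAt
  have hd := HasDerivAt.comp ((1 : ℝ) : ℂ) hP' hc
  have hdr : HasDerivAt (fun t : ℝ ↦ (P (t * z₀)).re) (deriv P z₀ * z₀).re 1 :=
    hd.real_of_complex
  have hdc : HasDerivAt (fun t : ℝ ↦ P (t * z₀)) (deriv P z₀ * z₀) 1 := hd.comp_ofReal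
  have hdn := ((hdc.add_const 1).norm_sq)
  have hpow := ((hasDerivAt_pow (2 * n) (1 : ℝ)).const_sub 1)
  have hφ := hdr.sub ((hpow.mul hdn).div_const 4)
  have hle := hφ.nonpos_of_nonneg_left (by simp [h₀]) ?_
  · simp [h₀] at hle
    have : ‖P z₀ + 1‖ ^ 2 = 1 + (P z₀).im ^ 2 := by
      rw [Complex.sq_norm, normSq_apply]
      simp [h₀]
      ring
    rw [this] at hle
    simp
    linarith
  · filter_upwards [Ioo_mem_nhdsLT (zero_lt_one' ℝ)] with t ht
    have hn : ‖(t : ℂ) * z₀‖ = t * ‖z₀‖ := by simp [abs_of_pos ht.1]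
    have hb := norm_sub_one_le_of_re_nonneg hr hP hk hPk hre (z := t * z₀)
      (by rw [mem_closedBall_zero_iff, hn]; nlinarith [ht.2])
    rw [hn, mul_div_cancel_right₀ _ hr.ne'] at hb
    have hb2 := pow_le_pow_left₀ (norm_nonneg _) hb 2
    rw [mul_pow, ← pow_mul, mul_comm n 2] at hb2
    have hid : ‖P (t * z₀) + 1‖ ^ 2 - ‖P (t * z₀) - 1‖ ^ 2 = 4 * (P (t * z₀)).re := by
      rw [Complex.sq_norm, Complex.sq_norm, normSq_apply, normSq_apply]
      simp
      ring
    simp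
    linarith

theorem exists_first_zero_re {P : ℂ → ℂ} {R : ℝ}
    (hP : ContinuousOn P (ball 0 R)) (h0 : 0 < (P 0).re) {z₁ : ℂ} (hz₁ : z₁ ∈ ball (0 : ℂ) R)
    (hbad : (P z₁).re ≤ 0) :
    ∃ z₀ ∈ ball (0 : ℂ) R, z₀ ≠ 0 ∧ (P z₀).re = 0 ∧
      ∀ z ∈ closedBall (0 : ℂ) ‖z₀‖, 0 ≤ (P z).re := by
  have hsub : closedBall (0 : ℂ) ‖z₁‖ ⊆ ball 0 R := closedBall_subset_ball (by simpa using hz₁)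
  have hcre : ContinuousOn (fun z ↦ (P z).re) (closedBall 0 ‖z₁‖) :=
    continuous_re.comp_continuousOn (hP.mono hsub)
  have hcomp : IsCompact (closedBall (0 : ℂ) ‖z₁‖ ∩ (fun z ↦ (P z).re) ⁻¹' Set.Iic 0) :=
    (isCompact_closedBall _ _).of_isClosed_subset
      (hcre.preimage_isClosed_of_isClosed isClosed_closedBall isClosed_Iic) Set.inter_subset_left
  obtain ⟨z₀, ⟨hz₀, hz₀'⟩, hmin⟩ := hcomp.exists_isMinOn ⟨z₁, by simp, hbad⟩
    continuous_norm.continuousOn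
  have hz₀'' : (P z₀).re ≤ 0 := hz₀'
  have hne : z₀ ≠ 0 := by
    rintro rfl
    linarith
  have hle : ‖z₀‖ ≤ ‖z₁‖ := by simpa using hz₀
  have hpos : ∀ z ∈ ball (0 : ℂ) ‖z₀‖, 0 ≤ (P z).re := by
    intro z hz
    by_contra! hneg
    have hz' : ‖z‖ < ‖z₀‖ := by simpa using hz
    have := hmin (a := z) ⟨by simp; linarith, hneg.le⟩
    simp at this
    linarith
  have hcl : ∀ z ∈ closedBall (0 : ℂ) ‖z₀‖, 0 ≤ (P z).re := by
    intro z hz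
    have hcl := closure_ball (0 : ℂ) (norm_ne_zero_iff.2 hne)
    exact le_on_closure hpos continuousOn_const
      (hcre.mono (hcl ▸ closedBall_subset_closedBall hle)) (hcl ▸ hz)
  exact ⟨z₀, hsub hz₀, hne, le_antisymm hz₀'' (hcl z₀ (by simp)), hcl⟩

theorem exists_analyticAt_of_hasSum {h : ℂ → ℂ} {a : ℕ → ℂ} {m : ℕ}
    (hs : ∀ z ∈ ball (0 : ℂ) 1, HasSum (fun k : ℕ ↦ a k * z ^ (m + k)) (h z)) :
    ∃ g : ℂ → ℂ, AnalyticAt ℂ g 0 ∧ ∀ z ∈ ball (0 : ℂ) 1, h z = z ^ m * g z := by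
  have hsum : ∀ z ∈ ball (0 : ℂ) 1, HasSum (fun k : ℕ ↦ a k * z ^ k) (∑' k, a k * z ^ k) := by
    intro z hz
    refine Summable.hasSum ?_
    rcases eq_or_ne z 0 with rfl | hz0
    · exact summable_of_ne_finset_zero (s := {0}) fun k hk ↦ by simp at hk; simp [hk]
    · refine ((hs z hz).summable.mul_left (z ^ m)⁻¹).congr fun k ↦ ?_
      field_simp
      ring
  refine ⟨fun z ↦ ∑' k, a k * z ^ k, ?_, fun z hz ↦ ?_⟩
  · refine ⟨FormalMultilinearSeries.ofScalars ℂ a, hasFPowerSeriesAt_iff.2 ?_⟩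
    filter_upwards [ball_mem_nhds (0 : ℂ) one_pos] with z hz
    simpa [mul_comm] using hsum z hz
  · refine (hs z hz).unique ?_
    simpa only [pow_add, mul_left_comm] using (hsum z hz).mul_left (z ^ m)

theorem eventually_mul_deriv_eq {f g : ℂ → ℂ} {c : ℂ} {p n : ℕ} (hp : 0 < p)
    (hg : AnalyticAt ℂ g 0) (hf : ∀ᶠ z in nhds 0, f z = c * z ^ p + z ^ (p + n) * g z) :
    ∀ᶠ z in nhds 0, z * deriv f z =
      c * p * z ^ p + z ^ (p + n) * ((p + n) * g z + z * deriv g z) := by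
  filter_upwards [hf.eventually_nhds, hg.eventually_analyticAt] with z hz hgz
  have hd := ((hasDerivAt_pow p z).const_mul c).add
    ((hasDerivAt_pow (p + n) z).mul hgz.differentiableAt.hasDerivAt)
  rw [(hd.congr_of_eventuallyEq hz).deriv]
  obtain ⟨m, rfl⟩ := Nat.exists_eq_succ_of_ne_zero hp.ne'
  have : m.succ + n - 1 = m + n := by omega
  rw [this]
  push_cast
  simp only [Nat.succ_eq_add_one]
  ring

theorem exists_differentiableOn_mul_logDeriv_eq {F G : ℂ → ℂ} {c : ℂ} {p n : ℕ} (hp : 0 < p)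
    (hn : 0 < n) (hc : c ≠ 0) (hF : AnalyticOnNhd ℂ F (ball 0 1))
    (hne : ∀ z ∈ ball (0 : ℂ) 1, z ≠ 0 → F z ≠ 0) (hG : AnalyticAt ℂ G 0)
    (hFG : ∀ᶠ z in nhds 0, F z = c * z ^ p + z ^ (p + n) * G z) :
    ∃ k : ℂ → ℂ, (∀ z ∈ ball (0 : ℂ) 1, DifferentiableAt ℂ k z) ∧
      ∀ z ∈ ball (0 : ℂ) 1, z ≠ 0 → z * deriv F z / F z = p + z ^ n * k z := by
  set K : ℂ → ℂ := fun z ↦ (n * G z + z * deriv G z) / (c + z ^ n * G z) with hK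
  have hden : AnalyticAt ℂ (fun z ↦ c + z ^ n * G z) 0 := by fun_prop
  have hden0 : c + 0 ^ n * G 0 ≠ 0 := by simpa [hn.ne'] using hc
  have hKa : AnalyticAt ℂ K 0 := by
    have := hG.deriv
    exact AnalyticAt.div (by fun_prop) hden hden0
  set k : ℂ → ℂ := fun z ↦ if z = 0 then K 0 else (z * deriv F z / F z - p) / z ^ n with hk
  have hkK : k =ᶠ[nhds 0] K := by
    filter_upwards [hFG, eventually_mul_deriv_eq hp hG hFG,
      hden.continuousAt.eventually_ne hden0] with z h1 h2 h3
    rcases eq_or_ne z 0 with rfl | hz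
    · simp [hk]
    · have hzp : z ^ p ≠ 0 := pow_ne_zero _ hz
      have hzn : z ^ n ≠ 0 := pow_ne_zero _ hz
      have h4 : F z = z ^ p * (c + z ^ n * G z) := by rw [h1]; ring
      have h5 : z * deriv F z =
          z ^ p * (c * p + z ^ n * ((p + n) * G z + z * deriv G z)) := by rw [h2]; ring
      simp only [hk, hK, if_neg hz]
      rw [h4, h5, mul_div_mul_left _ _ hzp, div_sub' h3, div_div, div_eq_div_iff
        (mul_ne_zero h3 hzn) h3]
      ring
  refine ⟨k, fun z hz ↦ ?_, fun z hz hz0 ↦ ?_⟩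
  · rcases eq_or_ne z 0 with rfl | hz0
    · exact hKa.differentiableAt.congr_of_eventuallyEq hkK
    · have hFz := (hF z hz).differentiableAt
      have hFz' := (hF z hz).deriv.differentiableAt
      have hd : DifferentiableAt ℂ (fun z ↦ (z * deriv F z / F z - p) / z ^ n) z :=
        (((differentiableAt_id.mul hFz').div hFz (hne z hz hz0)).sub_const _).div
          (differentiableAt_pow n) (pow_ne_zero _ hz0)
      refine hd.congr_of_eventuallyEq ?_
      filter_upwards [isOpen_ne.mem_nhds hz0] with w hw
      simp only [hk]
      exact if_neg hw
  · simp only [hk, if_neg hz0]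
    field_simp
    ring

theorem mul_deriv_mul_logDeriv_div {F : ℂ → ℂ} {z : ℂ} (hF : AnalyticAt ℂ F z) (hz : z ≠ 0)
    (h0 : F z ≠ 0) (h1 : deriv F z ≠ 0) :
    z * deriv (fun w ↦ w * deriv F w / F w) z / (z * deriv F z / F z) =
      -(z * deriv F z / F z) + 1 + z * deriv (deriv F) z / deriv F z := by
  have hd := ((hasDerivAt_id z).mul hF.deriv.differentiableAt.hasDerivAt).div
    hF.differentiableAt.hasDerivAt h0
  have hd' : deriv (fun w ↦ w * deriv F w / F w) z = _ := hd.deriv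
  rw [hd']
  simp
  field_simp
  ring

theorem mul_div_normSq_le {n p δ ς x y : ℝ} (hn : 0 ≤ n) (hδ0 : 0 ≤ δ) (hδ : δ < p)
    (hς1 : δ ≤ p / 2 → ς = -(n * δ) / (2 * (p - δ)))
    (hς2 : p / 2 ≤ δ → ς = -(n * (p - δ)) / (2 * δ))
    (hy : y ≤ -(n * (1 + x ^ 2)) / 2) (hD : 0 < δ ^ 2 + ((p - δ) * x) ^ 2) :
    (p - δ) * y * δ / (δ ^ 2 + ((p - δ) * x) ^ 2) ≤ ς := by
  have hpδ : 0 < p - δ := sub_pos.2 hδ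
  rw [div_le_iff₀ hD]
  have h1 : (p - δ) * y * δ ≤ (p - δ) * (-(n * (1 + x ^ 2)) / 2) * δ := by gcongr
  refine h1.trans ?_
  rcases le_total δ (p / 2) with h | h
  · rw [hς1 h, div_mul_eq_mul_div, le_div_iff₀ (by positivity)]
    have : 0 ≤ n * δ * ((p - δ) ^ 2 - δ ^ 2) :=
      mul_nonneg (by positivity) (by nlinarith)
    nlinarith
  · have hδ' : 0 < δ := by linarith
    rw [hς2 h, div_mul_eq_mul_div, le_div_iff₀ (by positivity)]
    have : 0 ≤ n * (p - δ) * (x ^ 2 * (δ ^ 2 - (p - δ) ^ 2)) :=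
      mul_nonneg (by positivity) (mul_nonneg (sq_nonneg _) (by nlinarith))
    nlinarith

theorem stmt_12 (p n : ℕ) (hp : 0 < p) (hn : 0 < n) (lam : ℝ)
    (hlam0 : 0 ≤ lam) (hlam1 : lam ≤ 1)
    (f F : ℂ → ℂ)
    (hf : AnalyticOnNhd ℂ f (ball 0 1))
    (hser : ∃ a : ℕ → ℂ, ∀ z ∈ ball (0:ℂ) 1,
      HasSum (fun k : ℕ => a k * z ^ (p + n + k)) (f z - z ^ p))
    (hF : ∀ z, F z = (1 - (lam:ℂ)) * f z + (lam:ℂ) * z * deriv f z)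
    (hne : ∀ z ∈ ball (0:ℂ) 1, z ≠ 0 → F z * deriv F z ≠ 0)
    (δ ς : ℝ) (hδ0 : 0 ≤ δ) (hδ : δ < (p:ℝ))
    (hς1 : δ ≤ (p:ℝ) / 2 → ς = -((n:ℝ) * δ) / (2 * ((p:ℝ) - δ)))
    (hς2 : (p:ℝ) / 2 ≤ δ → ς = -((n:ℝ) * ((p:ℝ) - δ)) / (2 * δ))
    (hhyp : ∀ z ∈ ball (0:ℂ) 1, z ≠ 0 →
      (-(z * deriv F z / F z) + 1 + z * deriv (deriv F) z / deriv F z).re > ς) :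
    ∀ z ∈ ball (0:ℂ) 1, z ≠ 0 →
      (z * deriv F z / F z).re > δ := by
  have hball : ball (0 : ℂ) 1 ∈ nhds 0 := ball_mem_nhds _ one_pos
  have hpδ : 0 < (p : ℝ) - δ := sub_pos.2 hδ
  have hpδ' : ((p : ℂ) - δ) ≠ 0 := by exact_mod_cast hpδ.ne'
  obtain ⟨a, ha⟩ := hser
  obtain ⟨g, hg, hfg⟩ := exists_analyticAt_of_hasSum ha
  have hfg' : ∀ᶠ z in nhds 0, f z = 1 * z ^ p + z ^ (p + n) * g z := by
    filter_upwards [hball] with z hz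
    linear_combination hfg z hz
  have hFan : AnalyticOnNhd ℂ F (ball 0 1) := by
    rw [funext hF]
    intro z hz
    have h1 := hf z hz
    have h2 := h1.deriv
    fun_prop
  have hFG : ∀ᶠ z in nhds 0, F z = ((1 + lam * (p - 1) : ℝ) : ℂ) * z ^ p + z ^ (p + n) *
      ((1 - lam) * g z + lam * ((p + n) * g z + z * deriv g z)) := by
    filter_upwards [hfg', eventually_mul_deriv_eq hp hg hfg'] with z h1 h2
    rw [hF, mul_assoc, h2, h1]
    push_cast
    ring
  have hc : ((1 + lam * (p - 1) : ℝ) : ℂ) ≠ 0 := by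
    have : (1 : ℝ) ≤ p := by exact_mod_cast hp
    have : 0 < 1 + lam * (p - 1) := by nlinarith
    exact_mod_cast this.ne'
  have hg' := hg.deriv
  obtain ⟨k, hk, hkF⟩ := exists_differentiableOn_mul_logDeriv_eq hp hn hc hFan
    (fun z hz hz0 ↦ left_ne_zero_of_mul (hne z hz hz0)) (by fun_prop) hFG
  set P : ℂ → ℂ := fun z ↦ 1 + z ^ n * (k z / (p - δ)) with hPdef
  have hP : ∀ z ∈ ball (0 : ℂ) 1, DifferentiableAt ℂ P z := fun z hz ↦ by
    have := hk z hz
    fun_prop (disch := assumption)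
  have hPF : ∀ z ∈ ball (0 : ℂ) 1, z ≠ 0 → z * deriv F z / F z = δ + (p - δ) * P z := by
    intro z hz hz0
    rw [hkF z hz hz0, hPdef]
    field_simp
    ring
  intro z₁ hz₁ hz₁0
  have hre : (z₁ * deriv F z₁ / F z₁).re = δ + (p - δ) * (P z₁).re := by
    rw [hPF z₁ hz₁ hz₁0, ← ofReal_natCast, ← ofReal_sub, add_re, re_ofReal_mul, ofReal_re]
  by_contra! hcon
  have hbad : (P z₁).re ≤ 0 := by
    by_contra! h
    nlinarith [mul_pos hpδ h]
  obtain ⟨z₀, hz₀, hz₀0, hP0, hPre⟩ := exists_first_zero_re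
    (fun z hz ↦ (hP z hz).continuousAt.continuousWithinAt) (by simp [hPdef, hn.ne']) hz₁ hbad
  have hsub : closedBall (0 : ℂ) ‖z₀‖ ⊆ ball 0 1 := closedBall_subset_ball (by simpa using hz₀)
  have him := im_mul_deriv_eq_zero_of_re_nonneg (hP z₀ hz₀) hPre hP0
  have hle := re_mul_deriv_le_of_re_nonneg hz₀0 (fun z hz ↦ hP z (hsub hz))
    (fun z hz ↦ (hk z (hsub hz)).div_const _) (fun z _ ↦ rfl) hPre hP0
  have hF0 := left_ne_zero_of_mul (hne z₀ hz₀ hz₀0)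
  have hF1 := right_ne_zero_of_mul (hne z₀ hz₀ hz₀0)
  have hev : (fun w ↦ w * deriv F w / F w) =ᶠ[nhds z₀] fun w ↦ δ + (p - δ) * P w := by
    filter_upwards [isOpen_ball.mem_nhds hz₀, isOpen_ne.mem_nhds hz₀0] with w hw hw0
    exact hPF w hw hw0
  have hder : deriv (fun w ↦ w * deriv F w / F w) z₀ = (p - δ) * deriv P z₀ := by
    rw [hev.deriv_eq]
    exact (((hP z₀ hz₀).hasDerivAt.const_mul _).const_add _).deriv
  have hq0 : (δ : ℂ) + (p - δ) * P z₀ ≠ 0 := by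
    rw [← hPF z₀ hz₀ hz₀0]
    exact div_ne_zero (mul_ne_zero hz₀0 hF1) hF0
  have hqeq : (δ : ℂ) + (p - δ) * P z₀ = ⟨δ, (p - δ) * (P z₀).im⟩ := by
    apply Complex.ext <;> simp [hP0]
  have hD : 0 < δ ^ 2 + (((p : ℝ) - δ) * (P z₀).im) ^ 2 := by
    have := normSq_pos.2 hq0
    rw [hqeq, normSq_mk] at this
    linarith
  have hnum : z₀ * ((p - δ) * deriv P z₀) = (((p - δ) * (z₀ * deriv P z₀).re : ℝ) : ℂ) := by
    have : z₀ * deriv P z₀ = ((z₀ * deriv P z₀).re : ℂ) :=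
      Complex.ext (by simp) (by simpa using him)
    rw [mul_left_comm, this]
    push_cast
    simp
  have hh := hhyp z₀ hz₀ hz₀0
  rw [← mul_deriv_mul_logDeriv_div (hFan z₀ hz₀) hz₀0 hF0 hF1, hPF z₀ hz₀ hz₀0, hder, hqeq, hnum,
    div_re, normSq_mk] at hh
  have := mul_div_normSq_le (Nat.cast_nonneg n) hδ0 hδ hς1 hς2 hle hD
  simp only [ofReal_re, ofReal_im, zero_mul, zero_div, add_zero] at hh
  rw [← sq, ← sq] at hh
  linarith
end

section
/- Let p,n be positive integers, 0 ≤ λ ≤ 1, and let f ∈ A(p,n) with F_λ(z)F_λ'(z) ≠ 0 on U\{0}, where F_λ(z) = (1−λ)f(z) + λzf'(z). Let δ ∈ [0, 1/p) and define ς₁(δ) = −nδp/(2(1−δp)) if δ ∈ [0, 1/(2p)], and ς₁(δ) = −n(1−δp)/(2δp) if δ ∈ [1/(2p), 1/p). If Re[ zF_λ'(z)/F_λ(z) − 1 − zF_λ''(z)/F_λ'(z) ] > ς₁(δ) for all z ∈ U, then Re[ F_λ(z)/(zF_λ'(z)) ] > δ for all z ∈ U. -/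
open Metric Complex

/-- First order condition for a function on `[0, 1]` that is maximal at `1`. -/
lemma deriv_nonneg_of_le_left {N : ℝ → ℝ} {d : ℝ} (hN : HasDerivAt N d 1)
    (h : ∀ t ∈ Set.Ico (0 : ℝ) 1, N t ≤ N 1) : 0 ≤ d := by
  have h2 := hasDerivAt_iff_tendsto_slope_left_right.1 hN |>.1
  refine ge_of_tendsto h2 ?_
  filter_upwards [Ico_mem_nhdsLT (show (0:ℝ) < 1 by norm_num)] with t ht
  rw [slope_def_field]
  exact div_nonneg_of_nonpos (by linarith [h t ht]) (by linarith [ht.2])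

lemma exists_differentiableOn_factor {a : ℕ → ℂ} {h : ℂ → ℂ} {m : ℕ}
    (hs : ∀ z ∈ ball (0:ℂ) 1, HasSum (fun k : ℕ => a k * z ^ (m + k)) (h z)) :
    ∃ g : ℂ → ℂ, DifferentiableOn ℂ g (ball 0 1) ∧ ∀ z ∈ ball (0:ℂ) 1, h z = z ^ m * g z := by
  have hsum : ∀ z ∈ ball (0:ℂ) 1, z ≠ 0 → Summable fun k => a k * z ^ k := by
    intro z hz hz0
    refine ((hs z hz).summable.mul_left (z ^ m)⁻¹).congr fun k => ?_
    rw [pow_add]; field_simp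
  refine ⟨fun z => ∑' k, a k * z ^ k, ?_, ?_⟩
  · intro z hz
    obtain ⟨r, hr1, hr2⟩ := exists_between (mem_ball_zero_iff.1 hz)
    have hr0 : 0 < r := (norm_nonneg z).trans_lt hr1
    have hrs : Summable fun k => ‖a k * (r:ℂ) ^ k‖ :=
      (hsum r (by simpa [abs_of_pos hr0] using hr2) (by exact_mod_cast hr0.ne')).norm
    have hd : DifferentiableOn ℂ (fun z => ∑' k, a k * z ^ k) (ball 0 r) := by
      refine differentiableOn_tsum_of_summable_norm hrs
        (fun k => (by fun_prop)) isOpen_ball fun k w hw => ?_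
      simp only [norm_mul, norm_pow, norm_real, Real.norm_of_nonneg hr0.le]
      have := (mem_ball_zero_iff.1 hw).le
      gcongr
    exact (hd.differentiableAt (isOpen_ball.mem_nhds (by simpa using hr1))).differentiableWithinAt
  · intro z hz
    rw [← (hs z hz).tsum_eq, ← tsum_mul_left]
    exact tsum_congr fun k => by ring

/-- A differential-subordination form of the Jack / Miller-Mocanu lemma. -/
lemma exists_first_boundary_point {Q M : ℂ → ℂ} {n : ℕ} (hn : 0 < n)
    (hQ : DifferentiableOn ℂ Q (ball 0 1)) (hM : DifferentiableOn ℂ M (ball 0 1))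
    (hQM : ∀ z ∈ ball (0:ℂ) 1, Q z = 1 + z ^ n * M z)
    (hneg : ∃ z ∈ ball (0:ℂ) 1, (Q z).re ≤ 0) :
    ∃ z ∈ ball (0:ℂ) 1, z ≠ 0 ∧ ∃ x y : ℝ, Q z = x * I ∧ z * deriv Q z = y ∧
      y ≤ -(n * (1 + x ^ 2)) / 2 := by
  obtain ⟨z₁, hz₁, hz₁Q⟩ := hneg
  have hsub : closedBall (0:ℂ) ‖z₁‖ ⊆ ball 0 1 :=
    closedBall_subset_ball (by simpa using hz₁)
  have hcont : ContinuousOn (fun z => (Q z).re) (ball 0 1) :=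
    continuous_re.comp_continuousOn hQ.continuousOn
  have hcomp : IsCompact (closedBall (0:ℂ) ‖z₁‖ ∩ (fun z => (Q z).re) ⁻¹' Set.Iic 0) :=
    (isCompact_closedBall _ _).of_isClosed_subset
      ((hcont.mono hsub).preimage_isClosed_of_isClosed isClosed_closedBall isClosed_Iic)
      Set.inter_subset_left
  obtain ⟨z₀, ⟨hz₀c, hz₀Q⟩, hmin⟩ := hcomp.exists_isMinOn ⟨z₁, by simp, hz₁Q⟩
    (continuous_norm.continuousOn)
  have hz₀ : z₀ ∈ ball (0:ℂ) 1 := hsub hz₀c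
  have hQ0 : Q 0 = 1 := by
    rw [hQM 0 (by simp)]; simp [hn.ne']
  have hz₀0 : z₀ ≠ 0 := by
    rintro rfl
    simp [hQ0] at hz₀Q
    linarith
  set r := ‖z₀‖ with hr
  have hr0 : 0 < r := norm_pos_iff.2 hz₀0
  have hrsub : closedBall (0:ℂ) r ⊆ ball 0 1 :=
    closedBall_subset_ball (by simpa using hz₀)
  have hpos : ∀ z ∈ ball (0:ℂ) r, 0 < (Q z).re := by
    intro z hz
    by_contra! hcon
    have hz' : ‖z‖ < r := by simpa using hz
    have h1 : ‖z₀‖ ≤ ‖z‖ := hmin ⟨by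
      have : r ≤ ‖z₁‖ := by simpa using hz₀c
      simpa using hz'.le.trans this, hcon⟩
    linarith
  have hnn : ∀ z ∈ closedBall (0:ℂ) r, 0 ≤ (Q z).re := by
    intro z hz
    rw [← closure_ball 0 hr0.ne'] at hz hrsub
    exact closure_minimal (fun w hw => (⟨subset_closure hw, (hpos w hw).le⟩ :
        w ∈ closure (ball (0:ℂ) r) ∩ (fun z => (Q z).re) ⁻¹' Set.Ici 0))
      ((hcont.mono hrsub).preimage_isClosed_of_isClosed isClosed_closure isClosed_Ici) hz |>.2
  have hre : (Q z₀).re = 0 := le_antisymm hz₀Q (hnn z₀ (by simp [hr]))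
  have hQd : ∀ z ∈ ball (0:ℂ) 1, HasDerivAt Q (deriv Q z) z := fun z hz =>
    (hQ.differentiableAt (isOpen_ball.mem_nhds hz)).hasDerivAt
  have hv : ∀ z ∈ closedBall (0:ℂ) r, ‖M z / (Q z + 1)‖ ≤ (r ^ n)⁻¹ := by
    have hne : ∀ z ∈ closedBall (0:ℂ) r, Q z + 1 ≠ 0 := by
      intro z hz h0
      have h1 := hnn z hz
      have h2 := congrArg re h0
      simp at h2
      linarith
    have hd : DifferentiableOn ℂ (fun z => M z / (Q z + 1)) (closedBall 0 r) :=
      (hM.mono hrsub).div ((hQ.mono hrsub).add_const 1) hne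
    have hdc : DiffContOnCl ℂ (fun z => M z / (Q z + 1)) (ball 0 r) := by
      refine DifferentiableOn.diffContOnCl ?_
      rwa [closure_ball 0 hr0.ne']
    intro z hz
    refine norm_le_of_forall_mem_frontier_norm_le isBounded_ball hdc (fun w hw => ?_)
      (by rwa [closure_ball 0 hr0.ne'])
    rw [frontier_ball 0 hr0.ne'] at hw
    have hwr : ‖w‖ = r := by simpa using hw
    have hwc := sphere_subset_closedBall hw
    have h1 : w ^ n * M w = Q w - 1 := by rw [hQM w (hrsub hwc)]; ring
    have h2 : r ^ n * ‖M w‖ = ‖Q w - 1‖ := by rw [← h1, norm_mul, norm_pow, hwr]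
    have h3 : ‖Q w - 1‖ ≤ ‖Q w + 1‖ := by
      rw [← sq_le_sq₀ (norm_nonneg _) (norm_nonneg _), Complex.sq_norm, Complex.sq_norm,
        normSq_apply, normSq_apply]
      simp
      nlinarith [hnn w hwc]
    rw [norm_div, div_le_iff₀ (norm_pos_iff.2 (hne w hwc)), inv_mul_eq_div,
      le_div_iff₀ (by positivity)]
    linarith
  have hrad : ∀ t ∈ Set.Ico (0:ℝ) 1,
      ((Q (t * z₀)).re - 1) ^ 2 + (Q (t * z₀)).im ^ 2
        - t ^ (2 * n) * (((Q (t * z₀)).re + 1) ^ 2 + (Q (t * z₀)).im ^ 2) ≤ 0 := by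
    intro t ht
    have hmem : (t:ℂ) * z₀ ∈ closedBall (0:ℂ) r := by
      simp only [mem_closedBall_zero_iff, norm_mul, norm_real, Real.norm_of_nonneg ht.1]
      exact mul_le_of_le_one_left hr0.le ht.2.le
    have h1 := hv _ hmem
    have hne : Q (t * z₀) + 1 ≠ 0 := by
      intro h0
      have h1 := hnn _ hmem
      have h2 := congrArg re h0
      simp at h2
      linarith
    rw [norm_div, div_le_iff₀ (norm_pos_iff.2 hne), inv_mul_eq_div,
      le_div_iff₀ (by positivity)] at h1
    have h2 : Q (t * z₀) - 1 = (t * z₀) ^ n * M (t * z₀) := by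
      rw [hQM _ (hrsub hmem)]; ring
    have h3 : ‖Q (t * z₀) - 1‖ ≤ t ^ n * ‖Q (t * z₀) + 1‖ := by
      rw [h2, norm_mul, norm_pow, norm_mul, norm_real, Real.norm_of_nonneg ht.1, mul_pow, ← hr]
      have := mul_le_mul_of_nonneg_left h1 (pow_nonneg ht.1 n)
      linarith
    have h4 := pow_le_pow_left₀ (norm_nonneg _) h3 2
    rw [mul_pow, Complex.sq_norm, Complex.sq_norm, normSq_apply, normSq_apply] at h4
    simp at h4
    have h5 : t ^ (2 * n) = (t ^ n) ^ 2 := by ring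
    rw [h5]
    linarith
  have hline : HasDerivAt (fun t : ℝ => Q (t * z₀)) (z₀ * deriv Q z₀) 1 := by
    have h1 : HasDerivAt (fun t : ℝ => (t:ℂ) * z₀) (1 * z₀) 1 :=
      (ofRealCLM.hasDerivAt (x := (1:ℝ))).mul_const z₀
    have h2 : HasDerivAt Q (deriv Q z₀) (((1:ℝ):ℂ) * z₀) := by simpa using hQd z₀ hz₀
    rw [show z₀ * deriv Q z₀ = deriv Q z₀ * (1 * z₀) by ring]
    exact HasDerivAt.comp (1:ℝ) h2 h1
  have hX : HasDerivAt (fun t : ℝ => (Q (t * z₀)).re) (z₀ * deriv Q z₀).re 1 :=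
    reCLM.hasFDerivAt.comp_hasDerivAt (1:ℝ) hline
  have hY : HasDerivAt (fun t : ℝ => (Q (t * z₀)).im) (z₀ * deriv Q z₀).im 1 :=
    imCLM.hasFDerivAt.comp_hasDerivAt (1:ℝ) hline
  have hN := (((hX.sub_const 1).fun_pow 2).fun_add (hY.fun_pow 2)).fun_sub
    ((hasDerivAt_pow (2 * n) (1:ℝ)).fun_mul (((hX.add_const 1).fun_pow 2).fun_add (hY.fun_pow 2)))
  have hd := deriv_nonneg_of_le_left hN fun t ht => (hrad t ht).trans_eq (by simp [hre])
  have hcirc : HasDerivAt (fun θ : ℝ => Q (z₀ * exp (θ * I))) (I * (z₀ * deriv Q z₀)) 0 := by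
    have h0 : HasDerivAt (fun θ : ℝ => (θ:ℂ) * I) (1 * I) 0 :=
      (ofRealCLM.hasDerivAt (x := (0:ℝ))).mul_const I
    have h1 := (h0.cexp).const_mul z₀
    have h2 : HasDerivAt Q (deriv Q z₀) (z₀ * exp (((0:ℝ):ℂ) * I)) := by simpa using hQd z₀ hz₀
    rw [show I * (z₀ * deriv Q z₀) = deriv Q z₀ * (z₀ * (exp (((0:ℝ):ℂ) * I) * (1 * I))) by
      simp; ring]
    exact HasDerivAt.comp (0:ℝ) h2 h1
  have hcre : HasDerivAt (fun θ : ℝ => (Q (z₀ * exp (θ * I))).re) (I * (z₀ * deriv Q z₀)).re 0 :=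
    reCLM.hasFDerivAt.comp_hasDerivAt (0:ℝ) hcirc
  have him : (I * (z₀ * deriv Q z₀)).re = 0 := by
    refine IsLocalMin.hasDerivAt_eq_zero (Filter.Eventually.of_forall fun θ => ?_) hcre
    simp only [ofReal_zero, zero_mul, Complex.exp_zero, mul_one, hre]
    exact hnn _ (by simp [norm_exp_ofReal_mul_I, hr])
  have him' : (z₀ * deriv Q z₀).im = 0 := by
    rw [I_mul_re] at him; linarith
  refine ⟨z₀, hz₀, hz₀0, (Q z₀).im, (z₀ * deriv Q z₀).re, ?_, ?_, ?_⟩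
  · apply Complex.ext <;> simp [hre]
  · exact Complex.ext (by simp) (by simpa using him')
  · rw [him'] at hd
    generalize (z₀ * deriv Q z₀).re = y at hd ⊢
    simp [hre] at hd
    linarith

/-- The extremal estimate over the imaginary axis. -/
lemma re_div_le_of_imaginary_axis {n : ℕ} {α ς x y : ℝ} (hα0 : 0 ≤ α) (hα1 : α < 1)
    (hς1 : α ≤ 1 / 2 → ς = -(n * α) / (2 * (1 - α)))
    (hς2 : 1 / 2 ≤ α → ς = -(n * (1 - α)) / (2 * α))
    (hy : y ≤ -(n * (1 + x ^ 2)) / 2) (hD : α ≠ 0 ∨ x ≠ 0) :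
    (((1 - α) * y : ℝ) / (α + (1 - α) * (x * I)) : ℂ).re ≤ ς := by
  have hval : (((1 - α) * y : ℝ) / (α + (1 - α) * (x * I)) : ℂ).re
      = (1 - α) * y * α / (α ^ 2 + (1 - α) ^ 2 * x ^ 2) := by
    rw [div_re, normSq_apply]
    simp
    ring
  have hpos : 0 < α ^ 2 + (1 - α) ^ 2 * x ^ 2 := by
    have : 0 < 1 - α := by linarith
    rcases hD with h | h <;> positivity
  have hn : (0:ℝ) ≤ n := n.cast_nonneg
  rw [hval, div_le_iff₀ hpos]
  have hb : (1 - α) * y * α ≤ (1 - α) * α * (-(n * (1 + x ^ 2)) / 2) := by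
    have := mul_le_mul_of_nonneg_left hy (mul_nonneg (by linarith : 0 ≤ 1 - α) hα0)
    linarith
  refine hb.trans ?_
  rcases le_total α (1 / 2) with h | h
  · have h1 : 0 < 1 - α := by linarith
    rw [hς1 h, div_mul_eq_mul_div, le_div_iff₀ (by linarith)]
    have : 0 ≤ n * α * ((1 - α) ^ 2 - α ^ 2) := by
      apply mul_nonneg (by positivity); nlinarith
    nlinarith
  · have h1 : 0 < α := by linarith
    rw [hς2 h, div_mul_eq_mul_div, le_div_iff₀ (by linarith)]
    have : 0 ≤ n * (1 - α) * (x ^ 2 * (α ^ 2 - (1 - α) ^ 2)) := by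
      apply mul_nonneg (mul_nonneg hn (by linarith)) (mul_nonneg (sq_nonneg _) (by nlinarith))
    nlinarith

lemma mul_deriv_eq_of_factor {F G : ℂ → ℂ} {c : ℂ} {p n : ℕ} (hp : 0 < p)
    (hG : DifferentiableOn ℂ G (ball 0 1))
    (hFG : ∀ z ∈ ball (0:ℂ) 1, F z = c * z ^ p + z ^ (p + n) * G z)
    {z : ℂ} (hz : z ∈ ball (0:ℂ) 1) :
    z * deriv F z = z ^ p * (c * p + z ^ n * ((p + n) * G z + z * deriv G z)) := by
  have hnhds := isOpen_ball.mem_nhds hz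
  have hGd := (hG.differentiableAt hnhds).hasDerivAt
  have hd := ((hasDerivAt_pow p z).const_mul c).add ((hasDerivAt_pow (p + n) z).mul hGd)
  have hev : F =ᶠ[nhds z] (fun z => c * z ^ p) + (fun z => z ^ (p + n)) * G := by
    filter_upwards [hnhds] with w hw using hFG w hw
  rw [hev.deriv_eq, hd.deriv]
  obtain ⟨m, rfl⟩ : ∃ m, p = m + 1 := ⟨p - 1, by omega⟩
  rw [show m + 1 + n - 1 = m + n by omega, Nat.add_sub_cancel]
  push_cast
  ring

lemma exists_factor_of_combination {f F g : ℂ → ℂ} {lam : ℝ} {p n : ℕ} (hp : 0 < p)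
    (hlam : 0 ≤ lam) (hg : DifferentiableOn ℂ g (ball 0 1))
    (hfg : ∀ z ∈ ball (0:ℂ) 1, f z = 1 * z ^ p + z ^ (p + n) * g z)
    (hF : ∀ z, F z = (1 - (lam:ℂ)) * f z + (lam:ℂ) * z * deriv f z) :
    ∃ (c : ℂ) (G : ℂ → ℂ), c ≠ 0 ∧ DifferentiableOn ℂ G (ball 0 1) ∧
      ∀ z ∈ ball (0:ℂ) 1, F z = c * z ^ p + z ^ (p + n) * G z := by
  have hdg := hg.deriv isOpen_ball
  refine ⟨1 - lam + lam * p,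
    fun z => (1 - lam) * g z + lam * ((p + n) * g z + z * deriv g z), ?_, by fun_prop, ?_⟩
  · have hp1 : (1:ℝ) ≤ p := by exact_mod_cast hp
    have : (1 - lam + lam * p : ℝ) ≠ 0 := by nlinarith
    exact_mod_cast this
  · intro z hz
    rw [hF, mul_assoc, mul_deriv_eq_of_factor hp hg hfg hz, hfg z hz]
    ring

lemma logDeriv_quotient {F : ℂ → ℂ} (hF : DifferentiableOn ℂ F (ball 0 1)) {w : ℂ}
    (hw : w ∈ ball (0:ℂ) 1) (hw0 : w ≠ 0) (hFw : F w ≠ 0) (hFw' : deriv F w ≠ 0) :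
    w * deriv (fun z => F z / (z * deriv F z)) w / (F w / (w * deriv F w))
      = w * deriv F w / F w - 1 - w * deriv (deriv F) w / deriv F w := by
  have hnhds := isOpen_ball.mem_nhds hw
  have h1 := (hF.differentiableAt hnhds).hasDerivAt
  have h2 := ((hF.deriv isOpen_ball).differentiableAt hnhds).hasDerivAt
  have h3 := h1.fun_div ((hasDerivAt_id' w).fun_mul h2) (mul_ne_zero hw0 hFw')
  rw [h3.deriv]
  field_simp
  ring

theorem stmt_14 (p n : ℕ) (hp : 0 < p) (hn : 0 < n) (lam : ℝ)
    (hlam0 : 0 ≤ lam) (hlam1 : lam ≤ 1)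
    (f F : ℂ → ℂ)
    (hf : AnalyticOnNhd ℂ f (ball 0 1))
    (hser : ∃ a : ℕ → ℂ, ∀ z ∈ ball (0:ℂ) 1,
      HasSum (fun k : ℕ => a k * z ^ (p + n + k)) (f z - z ^ p))
    (hF : ∀ z, F z = (1 - (lam:ℂ)) * f z + (lam:ℂ) * z * deriv f z)
    (hne : ∀ z ∈ ball (0:ℂ) 1, z ≠ 0 → F z * deriv F z ≠ 0)
    (δ ς : ℝ) (hδ0 : 0 ≤ δ) (hδ : δ < 1 / (p:ℝ))
    (hς1 : δ ≤ 1 / (2 * (p:ℝ)) → ς = -((n:ℝ) * δ * (p:ℝ)) / (2 * (1 - δ * (p:ℝ))))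
    (hς2 : 1 / (2 * (p:ℝ)) ≤ δ → ς = -((n:ℝ) * (1 - δ * (p:ℝ))) / (2 * δ * (p:ℝ)))
    (hhyp : ∀ z ∈ ball (0:ℂ) 1, z ≠ 0 →
      (z * deriv F z / F z - 1 - z * deriv (deriv F) z / deriv F z).re > ς) :
    ∀ z ∈ ball (0:ℂ) 1, z ≠ 0 →
      (F z / (z * deriv F z)).re > δ := by
  obtain ⟨a, ha⟩ := hser
  obtain ⟨g, hg, hfg⟩ := exists_differentiableOn_factor ha
  obtain ⟨c, G, hc, hG, hFG⟩ := exists_factor_of_combination (n := n) hp hlam0 hg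
    (fun z hz => by linear_combination hfg z hz) hF
  have hp0 : (p:ℂ) ≠ 0 := by exact_mod_cast hp.ne'
  have hpR : (0:ℝ) < p := by exact_mod_cast hp
  have hα0 : 0 ≤ δ * p := by positivity
  have hα1 : δ * p < 1 := by rwa [lt_div_iff₀ hpR] at hδ
  have hαC : (1 - δ * p : ℂ) ≠ 0 := by
    have : (1 - δ * p : ℝ) ≠ 0 := by linarith
    exact_mod_cast this
  have hFd : DifferentiableOn ℂ F (ball 0 1) := by
    refine DifferentiableOn.congr (f := fun z => c * z ^ p + z ^ (p + n) * G z) ?_ hFG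
    fun_prop
  have hdG := hG.deriv isOpen_ball
  set K : ℂ → ℂ := fun z => (p + n) * G z + z * deriv G z with hK
  have hKd : DifferentiableOn ℂ K (ball 0 1) := by fun_prop
  have hzF : ∀ z ∈ ball (0:ℂ) 1, z * deriv F z = z ^ p * (c * p + z ^ n * K z) :=
    fun z hz => mul_deriv_eq_of_factor hp hG hFG hz
  set D : ℂ → ℂ := fun z => c * p + z ^ n * K z with hD
  have hDd : DifferentiableOn ℂ D (ball 0 1) := by fun_prop
  have hD0 : ∀ z ∈ ball (0:ℂ) 1, D z ≠ 0 := by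
    intro z hz h0
    rcases eq_or_ne z 0 with rfl | hz0
    · simp [hD, hn.ne', hc, hp0] at h0
    · have h1 := hzF z hz
      rw [show c * p + z ^ n * K z = D z from rfl, h0, mul_zero] at h1
      exact (mul_ne_zero hz0 (right_ne_zero_of_mul (hne z hz hz0))) h1
  set Q : ℂ → ℂ := fun z => (p * ((c + z ^ n * G z) / D z) - δ * p) / (1 - δ * p) with hQ
  set M : ℂ → ℂ := fun z => (p * G z - K z) / D z / (1 - δ * p) with hM
  have hQd : DifferentiableOn ℂ Q (ball 0 1) := by
    refine DifferentiableOn.div_const (DifferentiableOn.sub_const (DifferentiableOn.const_mul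
      (DifferentiableOn.div (by fun_prop) hDd hD0) _) _) _
  have hMd : DifferentiableOn ℂ M (ball 0 1) :=
    (DifferentiableOn.div (by fun_prop) hDd hD0).div_const _
  have hQM : ∀ z ∈ ball (0:ℂ) 1, Q z = 1 + z ^ n * M z := by
    intro z hz
    have h0 := hD0 z hz
    obtain ⟨β, hβ⟩ : ∃ β : ℂ, β = 1 - δ * p := ⟨_, rfl⟩
    have hαβ : (δ * p : ℂ) = 1 - β := by rw [hβ]; ring
    rw [← hβ] at hαC
    simp only [hQ, hM]
    rw [← hβ, hαβ]
    field_simp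
    simp only [hD]
    ring
  have hq : ∀ z ∈ ball (0:ℂ) 1, z ≠ 0 →
      F z / (z * deriv F z) = (δ * p + (1 - δ * p) * Q z) / p := by
    intro z hz hz0
    have h0 := hD0 z hz
    rw [hzF z hz, hFG z hz]
    change _ / (z ^ p * D z) = _
    simp only [hQ]
    field_simp
    ring
  intro z hz hz0
  by_contra! hcon
  obtain ⟨w, hw, hw0, x, y, hQw, hQw', hy⟩ := exists_first_boundary_point hn hQd hMd hQM ⟨z, hz, by
    rw [hq z hz hz0] at hcon
    have h1 : (((δ * p + (1 - δ * p) * Q z) / p : ℂ)).re = (δ * p + (1 - δ * p) * (Q z).re) / p := by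
      rw [← ofReal_natCast, div_ofReal_re]
      simp
    rw [h1, div_le_iff₀ hpR] at hcon
    by_contra! h2
    nlinarith⟩
  have hFw := left_ne_zero_of_mul (hne w hw hw0)
  have hFw' := right_ne_zero_of_mul (hne w hw hw0)
  have hqw := hq w hw hw0
  have hlog := logDeriv_quotient hFd hw hw0 hFw hFw'
  have hderiv : deriv (fun z => F z / (z * deriv F z)) w = (1 - δ * p) * deriv Q w / p := by
    have hev : (fun z => F z / (z * deriv F z)) =ᶠ[nhds w]
        fun z => (δ * p + (1 - δ * p) * Q z) / p := by
      filter_upwards [isOpen_ball.mem_nhds hw, isOpen_ne.mem_nhds hw0] with z h1 h2 using hq z h1 h2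
    rw [hev.deriv_eq]
    have hQw := (hQd.differentiableAt (isOpen_ball.mem_nhds hw)).hasDerivAt
    exact (((hQw.const_mul _).const_add _).div_const _).deriv
  have hmain : w * deriv F w / F w - 1 - w * deriv (deriv F) w / deriv F w
      = (((1 - δ * p) * y : ℝ) / ((δ * p : ℝ) + (1 - (δ * p : ℝ)) * (x * I)) : ℂ) := by
    rw [← hlog, hderiv, hqw, hQw]
    push_cast
    rw [← hQw']
    field_simp
  have hle := re_div_le_of_imaginary_axis (n := n) (ς := ς) hα0 hα1
    (fun h => by
      rw [hς1 (by rw [le_div_iff₀ (by positivity)]; linarith), mul_assoc])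
    (fun h => by
      rw [hς2 (by rw [div_le_iff₀ (by positivity)]; linarith), mul_assoc 2])
    hy (by
      by_contra! h
      have h1 : (δ * p : ℂ) = 0 := by exact_mod_cast h.1
      rw [hQw, h1, h.2] at hqw
      simp [hFw, hFw', hw0] at hqw)
  have := hhyp w hw hw0
  rw [hmain] at this
  linarith
end
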